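/- Almost self-dual modules are preserved: if Q and T are almost self-dual ℤ_p-submodules of H, then for every g ∈ GL(α+km, ℚ_p) the submodule χ_g(Q,T) ⊆ V⊕V is almost self-dual with respect to B^⊖. -/

import Mathlib

open scoped BigOperators

/-- The symplectic coordinate space `ℚ_p^n ⊕ ℚ_p^n`, written as pairs `(x⁺, x⁻)`. -/
abbrev SpV (p : ℕ) [Fact p.Prime] (n : ℕ) := (Fin n → ℚ_[p]) × (Fin n → ℚ_[p])

/-- The standard skew-symmetric bilinear form `B(x, y) = Σ_s (x_s⁺ y_s⁻ − x_s⁻ y_s⁺)`. -/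
noncomputable def Bform (p : ℕ) [Fact p.Prime] (n : ℕ) (x y : SpV p n) : ℚ_[p] :=
  ∑ s, (x.1 s * y.2 s - x.2 s * y.1 s)

/-- The form `B^⊖(u ⊕ v, u' ⊕ v') = B_V(u, u') − B_V(v, v')` on `V ⊕ V`. -/
noncomputable def Bminus (p : ℕ) [Fact p.Prime] (α : ℕ) (z w : SpV p α × SpV p α) : ℚ_[p] :=
  Bform p α z.1 w.1 - Bform p α z.2 w.2

/-- The dual module `P^⊥⊥ = {w : B(v,w) ∈ ℤ_p for all v ∈ P}` of a set `P` with respect to a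
bilinear form `B` (membership in `ℤ_p` expressed as `‖·‖ ≤ 1`). -/
def dualMod (p : ℕ) [Fact p.Prime] {X : Type*} (B : X → X → ℚ_[p]) (P : Set X) : Set X :=
  {w | ∀ v ∈ P, ‖B v w‖ ≤ 1}

/-- A set is *self-dual* with respect to `B` if it coincides with its dual module. -/
def IsSelfDual (p : ℕ) [Fact p.Prime] {X : Type*} (B : X → X → ℚ_[p]) (P : Set X) : Prop :=
  dualMod p B P = P

/-- A `ℤ_p`-submodule of a `ℚ_p`-vector space: a set containing `0`, closed under addition
and under multiplication by p-adic integers (scalars of norm at most 1). -/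
def IsZpSubmodule (p : ℕ) [Fact p.Prime] {X : Type*} [AddCommGroup X] [Module ℚ_[p] X]
    (P : Set X) : Prop :=
  (0 : X) ∈ P ∧ (∀ x ∈ P, ∀ y ∈ P, x + y ∈ P) ∧
    ∀ c : ℚ_[p], ‖c‖ ≤ 1 → ∀ x ∈ P, c • x ∈ P

/-- The index set `{1,…,α} ⊔ ({1,…,k} × {1,…,m})` for matrices in `GL(α + km, ℚ_p)`. -/
abbrev BigIx (α k m : ℕ) := Fin α ⊕ (Fin k × Fin m)

/-- Glue a vector `u ∈ ℚ_p^α` and a tuple `x = (x_1, …, x_k)` with `x_j ∈ ℚ_p^m` into a single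
vector indexed by `BigIx α k m`. -/
def glue {p α k m : ℕ} [Fact p.Prime] (u : Fin α → ℚ_[p]) (x : Fin k → Fin m → ℚ_[p]) :
    BigIx α k m → ℚ_[p] :=
  Sum.elim u fun js => x js.1 js.2

/-- The slice of a tuple `x = (x⁺, x⁻)` (with `x_j^± ∈ ℚ_p^m`) at coordinate `s`, as an
element of `H = ℚ_p^k ⊕ ℚ_p^k`. -/
def tupleSlice {p k m : ℕ} [Fact p.Prime]
    (xp xm : Fin k → Fin m → ℚ_[p]) (s : Fin m) : SpV p k :=
  (fun j => xp j s, fun j => xm j s)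

/-- **The characteristic function** `χ_g(Q, T)` of `g ∈ GL(α + km, ℚ_p)` (viewed as a matrix
`M` on the index set `BigIx α k m`): the set of all `(u⁺ ⊕ u⁻) ⊕ (v⁺ ⊕ v⁻) ∈ V ⊕ V` for which
there exist `x ∈ Q ⊗ ℤ_p^m` and `y ∈ T ⊗ ℤ_p^m` with `(v⁺, y⁺) = g (u⁺, x⁺)` and
`(u⁻, x⁻) = gᵗ (v⁻, y⁻)`. -/
def chiM (p α k m : ℕ) [Fact p.Prime]
    (M : Matrix (BigIx α k m) (BigIx α k m) ℚ_[p]) (Q T : Set (SpV p k)) :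
    Set (SpV p α × SpV p α) :=
  {uv | ∃ xp xm yp ym : Fin k → Fin m → ℚ_[p],
    (∀ s : Fin m, tupleSlice xp xm s ∈ Q) ∧
    (∀ s : Fin m, tupleSlice yp ym s ∈ T) ∧
    glue uv.2.1 yp = M.mulVec (glue uv.1.1 xp) ∧
    glue uv.1.2 xm = M.transpose.mulVec (glue uv.2.2 ym)}

/-- A set `P` is *almost self-dual* with respect to `B` if it contains a self-dual submodule
and `B(v, w) ∈ p^{-1} ℤ_p` (i.e. `‖B(v,w)‖ ≤ p`) for all `v, w ∈ P`. -/
def IsAlmostSelfDual (p : ℕ) [Fact p.Prime] {X : Type*}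
    (B : X → X → ℚ_[p]) (P : Set X) : Prop :=
  (∃ S : Set X, S ⊆ P ∧ IsSelfDual p B S) ∧ ∀ v ∈ P, ∀ w ∈ P, ‖B v w‖ ≤ (p : ℝ)

open Matrix

section Separation

variable {p : ℕ} [Fact p.Prime]

theorem IsZpSubmodule.sub_smul_mem {X : Type*} [AddCommGroup X] [Module ℚ_[p] X] {A : Set X}
    (hA : IsZpSubmodule p A) {x y : X} (hx : x ∈ A) (hy : y ∈ A) {c : ℚ_[p]} (hc : ‖c‖ ≤ 1) :
    x - c • y ∈ A := by
  have := hA.2.1 x hx _ (hA.2.2 (-c) (by rwa [norm_neg]) y hy)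
  rwa [neg_smul, ← sub_eq_add_neg] at this

theorem IsZpSubmodule.neg_mem {X : Type*} [AddCommGroup X] [Module ℚ_[p] X] {A : Set X}
    (hA : IsZpSubmodule p A) {x : X} (hx : x ∈ A) : -x ∈ A := by
  have := hA.2.2 (-1) (by simp) x hx
  rwa [neg_one_smul] at this

/-- If `f` is integral on the part of `A` where `g` vanishes, then some `f + c g` is integral
on all of `A`. -/
theorem exists_norm_add_mul_le_one {X : Type*} [AddCommGroup X] [Module ℚ_[p] X] {A : Set X}
    (hA : IsZpSubmodule p A) (f g : X →ₗ[ℚ_[p]] ℚ_[p])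
    (hfg : ∀ a ∈ A, g a = 0 → ‖f a‖ ≤ 1) :
    ∃ c : ℚ_[p], ∀ a ∈ A, ‖f a + c * g a‖ ≤ 1 := by
  classical
  by_cases h0 : ∀ a ∈ A, g a = 0
  · exact ⟨0, fun a ha => by simpa using hfg a ha (h0 a ha)⟩
  push Not at h0
  obtain ⟨a₀, ha₀, hg₀⟩ := h0
  have hclosed : ∀ a : A, IsClosed {c : ℚ_[p] | ‖f a + c * g a‖ ≤ 1} := fun a =>
    isClosed_le (by fun_prop) continuous_const
  have hcompact : IsCompact {c : ℚ_[p] | ‖f a₀ + c * g a₀‖ ≤ 1} := by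
    refine (isCompact_closedBall (-(f a₀ / g a₀)) (‖g a₀‖⁻¹)).of_isClosed_subset
      (hclosed ⟨a₀, ha₀⟩) fun c hc => ?_
    have hpos : 0 < ‖g a₀‖ := norm_pos_iff.2 hg₀
    rw [Metric.mem_closedBall, dist_eq_norm, ← one_div, le_div_iff₀ hpos, ← norm_mul]
    rw [sub_neg_eq_add, add_mul, div_mul_cancel₀ _ hg₀, add_comm]
    exact hc
  obtain ⟨c, -, hc⟩ := hcompact.inter_iInter_nonempty _ hclosed fun t => by
    obtain ⟨b, hb, hmax⟩ := (insert (⟨a₀, ha₀⟩ : A) t).exists_max_image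
      (fun a => ‖g a‖) ⟨_, Finset.mem_insert_self _ _⟩
    have hgb : g b ≠ 0 := norm_pos_iff.1
      ((norm_pos_iff.2 hg₀).trans_le (hmax _ (Finset.mem_insert_self _ _)))
    have key : ∀ a ∈ insert (⟨a₀, ha₀⟩ : A) t, ‖f a + -(f b / g b) * g a‖ ≤ 1 := by
      intro a ha
      have hle : ‖g a / g b‖ ≤ 1 := by
        rw [norm_div]
        exact div_le_one_of_le₀ (hmax a ha) (norm_nonneg _)
      have := hfg _ (hA.sub_smul_mem a.2 b.2 hle) (by simp [hgb])
      convert this using 2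
      simp only [map_sub, map_smul, smul_eq_mul]
      ring
    refine ⟨-(f b / g b), key _ (Finset.mem_insert_self _ _), ?_⟩
    simp only [Set.mem_iInter]
    exact fun a ha => key a (Finset.mem_insert_of_mem ha)
  exact ⟨c, fun a ha => Set.mem_iInter.1 hc ⟨a, ha⟩⟩

/-- A point outside a `ℤ_p`-submodule of a finite-dimensional space is separated from it by a
linear functional. -/
theorem IsZpSubmodule.exists_separating {X : Type*} [AddCommGroup X] [Module ℚ_[p] X]
    [FiniteDimensional ℚ_[p] X] {A : Set X} (hA : IsZpSubmodule p A) {w : X} (hw : w ∉ A) :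
    ∃ f : X →ₗ[ℚ_[p]] ℚ_[p], (∀ a ∈ A, ‖f a‖ ≤ 1) ∧ 1 < ‖f w‖ := by
  let P : Set (Submodule ℚ_[p] X) := {Y | w ∈ Y ∧ ∃ f : X →ₗ[ℚ_[p]] ℚ_[p],
    f w = (p : ℚ_[p])⁻¹ ∧ ∀ a ∈ A, a ∈ Y → ‖f a‖ ≤ 1}
  have hp1 : (1 : ℝ) < p := mod_cast (Fact.out : p.Prime).one_lt
  have hP : P.Nonempty := by
    have hw0 : w ≠ 0 := fun h => hw (h ▸ hA.1)
    obtain ⟨g, hg⟩ := Module.Projective.exists_dual_ne_zero ℚ_[p] hw0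
    refine ⟨ℚ_[p] ∙ w, Submodule.mem_span_singleton_self w, ((p : ℚ_[p])⁻¹ * (g w)⁻¹) • g,
      by simp [hg], fun a ha haw => ?_⟩
    obtain ⟨t, rfl⟩ := Submodule.mem_span_singleton.1 haw
    have ht : ‖t‖ < 1 := by
      by_contra! h
      have ht0 : t ≠ 0 := norm_pos_iff.1 (one_pos.trans_le h)
      apply hw
      simpa [smul_smul, ht0] using
        hA.2.2 t⁻¹ (by rw [norm_inv]; exact inv_le_one_of_one_le₀ h) _ ha
    have hdvd : ‖t‖ ≤ (p : ℝ)⁻¹ := by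
      have := (PadicInt.norm_lt_one_iff_dvd (⟨t, ht.le⟩ : ℤ_[p])).1 ht
      obtain ⟨s, hs⟩ := this
      have h2 : t = p * (s : ℚ_[p]) := by simpa using congrArg (Subtype.val) hs
      rw [h2, norm_mul, Padic.norm_p]
      exact mul_le_of_le_one_right (by positivity) s.2
    have : (((p : ℚ_[p])⁻¹ * (g w)⁻¹) • g) (t • w) = (p : ℚ_[p])⁻¹ * t := by
      simp only [LinearMap.smul_apply, map_smul, smul_eq_mul]
      field_simp
    rw [this, norm_mul, norm_inv, Padic.norm_p, inv_inv]
    calc (p : ℝ) * ‖t‖ ≤ p * (p : ℝ)⁻¹ := by gcongr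
      _ = 1 := mul_inv_cancel₀ (by positivity)
  obtain ⟨Y, ⟨hwY, f, hfw, hf⟩, hmax⟩ := set_has_maximal_iff_noetherian.2
    (inferInstance : IsNoetherian ℚ_[p] X) P hP
  have hY : Y = ⊤ := by
    by_contra hY
    obtain ⟨e, he⟩ : ∃ e, e ∉ Y := by
      by_contra! h
      exact hY ((Submodule.eq_top_iff').2 h)
    obtain ⟨g, hge, hgY⟩ := Submodule.exists_le_ker_of_notMem he
    have hB : IsZpSubmodule p (A ∩ (Y ⊔ ℚ_[p] ∙ e : Submodule ℚ_[p] X)) :=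
      ⟨⟨hA.1, zero_mem _⟩, fun x hx y hy => ⟨hA.2.1 x hx.1 y hy.1, add_mem hx.2 hy.2⟩,
        fun c hc x hx => ⟨hA.2.2 c hc x hx.1, Submodule.smul_mem _ c hx.2⟩⟩
    obtain ⟨c, hc⟩ := exists_norm_add_mul_le_one hB f g fun a ha hga => by
      refine hf a ha.1 ?_
      obtain ⟨y, hy, z, hz, rfl⟩ := Submodule.mem_sup.1 ha.2
      obtain ⟨t, rfl⟩ := Submodule.mem_span_singleton.1 hz
      have hgy : g y = 0 := hgY hy
      have ht : t = 0 := by simpa [hgy, hge] using hga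
      simpa [ht] using hy
    refine hmax (Y ⊔ ℚ_[p] ∙ e) ⟨Submodule.mem_sup_left hwY, f + c • g, ?_, ?_⟩ ?_
    · have : g w = 0 := hgY hwY
      simp [this, hfw]
    · exact fun a ha haY => hc a ⟨ha, haY⟩
    · refine lt_of_le_of_ne le_sup_left fun h => he ?_
      rw [h]
      exact Submodule.mem_sup_right (Submodule.mem_span_singleton_self e)
  subst hY
  refine ⟨f, fun a ha => hf a ha trivial, ?_⟩
  rw [hfw, norm_inv, Padic.norm_p, inv_inv]
  exact hp1

theorem eq_zero_of_norm_mul_le_one {x : ℚ_[p]} (h : ∀ t : ℚ_[p], ‖t * x‖ ≤ 1) : x = 0 := by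
  by_contra hx
  have := h ((p : ℚ_[p])⁻¹ * x⁻¹)
  rw [mul_assoc, inv_mul_cancel₀ hx, mul_one, norm_inv, Padic.norm_p, inv_inv] at this
  have hp1 : (1 : ℝ) < p := mod_cast (Fact.out : p.Prime).one_lt
  linarith

end Separation

section Forms

variable {p : ℕ} [Fact p.Prime]

theorem Bform_eq_dotProduct {n : ℕ} (x y : SpV p n) :
    Bform p n x y = x.1 ⬝ᵥ y.2 - x.2 ⬝ᵥ y.1 := by
  simp [Bform, dotProduct, Finset.sum_sub_distrib]

theorem Bform_swap {n : ℕ} (x y : SpV p n) : Bform p n x y = -Bform p n y x := by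
  rw [Bform_eq_dotProduct, Bform_eq_dotProduct, dotProduct_comm x.1, dotProduct_comm x.2]
  ring

theorem Bminus_swap {α : ℕ} (z w : SpV p α × SpV p α) :
    Bminus p α z w = -Bminus p α w z := by
  rw [Bminus, Bminus, Bform_swap z.1, Bform_swap z.2]
  ring

theorem IsSelfDual.isZpSubmodule {n : ℕ} {S : Set (SpV p n)} (hS : IsSelfDual p (Bform p n) S) :
    IsZpSubmodule p S := by
  rw [IsSelfDual] at hS
  rw [← hS]
  refine ⟨fun v _ => ?_, fun x hx y hy v hv => ?_, fun c hc x hx v hv => ?_⟩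
  · simp [Bform_eq_dotProduct]
  · have : Bform p n v (x + y) = Bform p n v x + Bform p n v y := by
      simp only [Bform_eq_dotProduct, Prod.fst_add, Prod.snd_add, dotProduct_add]
      ring
    rw [this]
    exact (Padic.nonarchimedean _ _).trans (max_le (hx v hv) (hy v hv))
  · have : Bform p n v (c • x) = c * Bform p n v x := by
      simp only [Bform_eq_dotProduct, Prod.smul_fst, Prod.smul_snd, dotProduct_smul, smul_eq_mul]
      ring
    rw [this, norm_mul]
    exact mul_le_one₀ hc (norm_nonneg _) (hx v hv)

theorem IsSelfDual.norm_le_one {X : Type*} {B : X → X → ℚ_[p]} {S : Set X}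
    (hS : IsSelfDual p B S) {v w : X} (hv : v ∈ S) (hw : w ∈ S) : ‖B v w‖ ≤ 1 := by
  rw [← hS] at hw
  exact hw v hv

variable {α k m : ℕ}

theorem glue_dotProduct_glue (u u' : Fin α → ℚ_[p]) (x x' : Fin k → Fin m → ℚ_[p]) :
    glue u x ⬝ᵥ glue u' x' = u ⬝ᵥ u' + ∑ s, ∑ j, x j s * x' j s := by
  simp [glue, dotProduct, Fintype.sum_prod_type_right]

theorem glue_symplectic (u u' : SpV p α) (xp xm xp' xm' : Fin k → Fin m → ℚ_[p]) :
    glue u.1 xp ⬝ᵥ glue u'.2 xm' - glue u.2 xm ⬝ᵥ glue u'.1 xp' =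
      Bform p α u u' + ∑ s, Bform p k (tupleSlice xp xm s) (tupleSlice xp' xm' s) := by
  rw [glue_dotProduct_glue, glue_dotProduct_glue]
  simp only [Bform_eq_dotProduct, tupleSlice, dotProduct, Finset.sum_sub_distrib]
  ring

theorem glue_restrict (a : BigIx α k m → ℚ_[p]) :
    glue (fun i => a (.inl i)) (fun j s => a (.inr (j, s))) = a := by
  funext i
  rcases i with i | ⟨j, s⟩ <;> rfl

/-- The graph relation transports the difference of the forms on the `H`-components to `B^⊖`. -/
theorem Bminus_eq_of_graph (M : Matrix (BigIx α k m) (BigIx α k m) ℚ_[p])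
    {z z' : SpV p α × SpV p α} {xp xm yp ym xp' xm' yp' ym' : Fin k → Fin m → ℚ_[p]}
    (h₁ : glue z.2.1 yp = M.mulVec (glue z.1.1 xp))
    (h₂ : glue z.1.2 xm = M.transpose.mulVec (glue z.2.2 ym))
    (h₁' : glue z'.2.1 yp' = M.mulVec (glue z'.1.1 xp'))
    (h₂' : glue z'.1.2 xm' = M.transpose.mulVec (glue z'.2.2 ym')) :
    Bminus p α z z' = ∑ s, Bform p k (tupleSlice yp ym s) (tupleSlice yp' ym' s) -
      ∑ s, Bform p k (tupleSlice xp xm s) (tupleSlice xp' xm' s) := by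
  have hx := glue_symplectic z.1 z'.1 xp xm xp' xm'
  have hy := glue_symplectic z.2 z'.2 yp ym yp' ym'
  have h : glue z.1.1 xp ⬝ᵥ glue z'.1.2 xm' - glue z.1.2 xm ⬝ᵥ glue z'.1.1 xp' =
      glue z.2.1 yp ⬝ᵥ glue z'.2.2 ym' - glue z.2.2 ym ⬝ᵥ glue z'.2.1 yp' := by
    rw [h₁, h₂, h₁', h₂', mulVec_transpose, mulVec_transpose, ← dotProduct_mulVec,
      dotProduct_comm (glue z.1.1 xp), ← dotProduct_mulVec, dotProduct_comm (glue z'.2.2 ym')]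
  rw [Bminus]
  linear_combination h - hx + hy

theorem norm_Bminus_le_of_mem_chiM (M : Matrix (BigIx α k m) (BigIx α k m) ℚ_[p])
    {Q T : Set (SpV p k)} {r : ℝ} (hr : 0 ≤ r) (hQ : ∀ v ∈ Q, ∀ w ∈ Q, ‖Bform p k v w‖ ≤ r)
    (hT : ∀ v ∈ T, ∀ w ∈ T, ‖Bform p k v w‖ ≤ r) {z z' : SpV p α × SpV p α}
    (hz : z ∈ chiM p α k m M Q T) (hz' : z' ∈ chiM p α k m M Q T) :
    ‖Bminus p α z z'‖ ≤ r := by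
  obtain ⟨xp, xm, yp, ym, hx, hy, h₁, h₂⟩ := hz
  obtain ⟨xp', xm', yp', ym', hx', hy', h₁', h₂'⟩ := hz'
  rw [Bminus_eq_of_graph M h₁ h₂ h₁' h₂', sub_eq_add_neg]
  refine (Padic.nonarchimedean _ _).trans (max_le ?_ ?_)
  · exact IsUltrametricDist.norm_sum_le_of_forall_le_of_nonneg hr
      fun s _ => hT _ (hy s) _ (hy' s)
  · rw [norm_neg]
    exact IsUltrametricDist.norm_sum_le_of_forall_le_of_nonneg hr
      fun s _ => hQ _ (hx s) _ (hx' s)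

/-- The product of `m` copies of `S`, placed in the `H`-coordinates of `ℚ_p^(α+km) ⊕ ℚ_p^(α+km)`
with vanishing `V`-coordinates. -/
def fiberModule (p α k m : ℕ) [Fact p.Prime] (S : Set (SpV p k)) :
    Set ((BigIx α k m → ℚ_[p]) × (BigIx α k m → ℚ_[p])) :=
  {q | ∃ xp xm : Fin k → Fin m → ℚ_[p], (∀ s, tupleSlice xp xm s ∈ S) ∧
    q = (glue 0 xp, glue 0 xm)}

theorem glue_add (u u' : Fin α → ℚ_[p]) (x x' : Fin k → Fin m → ℚ_[p]) :
    glue (u + u') (x + x') = glue u x + glue u' x' := by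
  funext i
  rcases i with i | ⟨j, s⟩ <;> rfl

theorem glue_smul (c : ℚ_[p]) (u : Fin α → ℚ_[p]) (x : Fin k → Fin m → ℚ_[p]) :
    glue (c • u) (c • x) = c • glue u x := by
  funext i
  rcases i with i | ⟨j, s⟩ <;> rfl

theorem glue_zero : glue (0 : Fin α → ℚ_[p]) (0 : Fin k → Fin m → ℚ_[p]) = 0 := by
  funext i
  rcases i with i | ⟨j, s⟩ <;> rfl

theorem IsZpSubmodule.fiberModule {S : Set (SpV p k)} (hS : IsZpSubmodule p S) :
    IsZpSubmodule p (fiberModule p α k m S) := by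
  refine ⟨⟨0, 0, fun _ => hS.1, by rw [glue_zero]; rfl⟩, ?_, ?_⟩
  · rintro _ ⟨xp, xm, hx, rfl⟩ _ ⟨xp', xm', hx', rfl⟩
    refine ⟨xp + xp', xm + xm', fun s => hS.2.1 _ (hx s) _ (hx' s), ?_⟩
    have hp := glue_add (0 : Fin α → ℚ_[p]) 0 xp xp'
    have hm := glue_add (0 : Fin α → ℚ_[p]) 0 xm xm'
    rw [add_zero] at hp hm
    rw [hp, hm]
    rfl
  · rintro c hc _ ⟨xp, xm, hx, rfl⟩
    refine ⟨c • xp, c • xm, fun s => hS.2.2 c hc _ (hx s), ?_⟩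
    have hp := glue_smul c (0 : Fin α → ℚ_[p]) xp
    have hm := glue_smul c (0 : Fin α → ℚ_[p]) xm
    rw [smul_zero] at hp hm
    rw [hp, hm]
    rfl

/-- A functional that is integral on the copies of `S` is given there by elements of the dual
of `S`. -/
theorem tupleSlice_mem_dualMod {S : Set (SpV p k)} (hS : IsZpSubmodule p S)
    {a d : BigIx α k m → ℚ_[p]}
    (h : ∀ q ∈ fiberModule p α k m S, ‖q.1 ⬝ᵥ d - q.2 ⬝ᵥ a‖ ≤ 1) (s : Fin m) :
    tupleSlice (fun j s => a (.inr (j, s))) (fun j s => d (.inr (j, s))) s ∈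
      dualMod p (Bform p k) S := by
  classical
  intro v hv
  let xp : Fin k → Fin m → ℚ_[p] := fun j t => if t = s then v.1 j else 0
  let xm : Fin k → Fin m → ℚ_[p] := fun j t => if t = s then v.2 j else 0
  have hs : tupleSlice xp xm s = v := by simp [tupleSlice, xp, xm]
  have ht : ∀ t, t ≠ s → tupleSlice xp xm t = 0 := fun t ht => by
    simp only [tupleSlice, xp, xm, if_neg ht]
    rfl
  have hmem : ∀ t, tupleSlice xp xm t ∈ S := fun t => by
    by_cases hts : t = s
    · rwa [hts, hs]
    · rw [ht t hts]
      exact hS.1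
  have := h _ ⟨xp, xm, hmem, rfl⟩
  have hsum := glue_symplectic (0 : SpV p α) (fun i => a (.inl i), fun i => d (.inl i)) xp xm
    (fun j s => a (.inr (j, s))) (fun j s => d (.inr (j, s)))
  rw [glue_restrict, glue_restrict, Finset.sum_eq_single s
    (fun t _ hts => by rw [ht t hts]; simp [Bform]) (by simp), hs] at hsum
  have h0 : ∀ y, Bform p α 0 y = 0 := fun y => by simp [Bform]
  rw [h0, zero_add] at hsum
  rw [← hsum]
  exact this

/-- The sum of the graph of `M` and the copies of `S` and `S'`. -/
def graphSum (M : Matrix (BigIx α k m) (BigIx α k m) ℚ_[p]) (S S' : Set (SpV p k)) :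
    Set (((BigIx α k m → ℚ_[p]) × (BigIx α k m → ℚ_[p])) ×
      ((BigIx α k m → ℚ_[p]) × (BigIx α k m → ℚ_[p]))) :=
  {z | ∃ a b, (a, Mᵀ *ᵥ b) - z.1 ∈ fiberModule p α k m S ∧
    (M *ᵥ a, b) - z.2 ∈ fiberModule p α k m S'}

theorem mem_graphSum_of_neg_mem (M : Matrix (BigIx α k m) (BigIx α k m) ℚ_[p])
    {S S' : Set (SpV p k)} {q q' : (BigIx α k m → ℚ_[p]) × (BigIx α k m → ℚ_[p])}
    (h : -q ∈ fiberModule p α k m S) (h' : -q' ∈ fiberModule p α k m S') :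
    (q, q') ∈ graphSum M S S' := by
  refine ⟨0, 0, ?_, ?_⟩
  · rw [mulVec_zero]
    exact (zero_sub q).symm ▸ h
  · rw [mulVec_zero]
    exact (zero_sub q').symm ▸ h'

theorem IsZpSubmodule.graphSum (M : Matrix (BigIx α k m) (BigIx α k m) ℚ_[p])
    {S S' : Set (SpV p k)} (hS : IsZpSubmodule p S) (hS' : IsZpSubmodule p S') :
    IsZpSubmodule p (graphSum M S S') := by
  have hN := hS.fiberModule (α := α) (m := m)
  have hN' := hS'.fiberModule (α := α) (m := m)
  refine ⟨mem_graphSum_of_neg_mem M (hN.neg_mem hN.1) (hN'.neg_mem hN'.1), ?_, ?_⟩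
  · rintro z ⟨a, b, h, h'⟩ z' ⟨a', b', g, g'⟩
    refine ⟨a + a', b + b', ?_, ?_⟩
    · convert hN.2.1 _ h _ g using 1
      ext <;> simp [mulVec_add] <;> ring
    · convert hN'.2.1 _ h' _ g' using 1
      ext <;> simp [mulVec_add] <;> ring
  · rintro c hc z ⟨a, b, h, h'⟩
    refine ⟨c • a, c • b, ?_, ?_⟩
    · convert hN.2.2 c hc _ h using 1
      ext <;> simp [mulVec_smul] <;> ring
    · convert hN'.2.2 c hc _ h' using 1
      ext <;> simp [mulVec_smul] <;> ring

/-- Every linear functional on the double of a symplectic coordinate space is represented by the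
difference of the symplectic forms. -/
theorem exists_symplectic_representation {ι : Type*} [Fintype ι]
    (f : (((ι → ℚ_[p]) × (ι → ℚ_[p])) × ((ι → ℚ_[p]) × (ι → ℚ_[p]))) →ₗ[ℚ_[p]] ℚ_[p]) :
    ∃ a d c b : ι → ℚ_[p], ∀ z, f z =
      (z.1.1 ⬝ᵥ d - z.1.2 ⬝ᵥ a) - (z.2.1 ⬝ᵥ b - z.2.2 ⬝ᵥ c) := by
  classical
  have hdual : ∀ g : (ι → ℚ_[p]) →ₗ[ℚ_[p]] ℚ_[p], ∃ v, ∀ x, g x = x ⬝ᵥ v := fun g =>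
    ⟨fun i => g (Pi.single i 1), fun x => by
      rw [LinearMap.pi_apply_eq_sum_univ g x]
      simp only [dotProduct, smul_eq_mul]
      refine Finset.sum_congr rfl fun i _ => ?_
      congr 2
      funext j
      simp [Pi.single_apply, eq_comm]⟩
  obtain ⟨v₁, h₁⟩ := hdual (f ∘ₗ .inl _ _ _ ∘ₗ .inl _ _ _)
  obtain ⟨v₂, h₂⟩ := hdual (f ∘ₗ .inl _ _ _ ∘ₗ .inr _ _ _)
  obtain ⟨v₃, h₃⟩ := hdual (f ∘ₗ .inr _ _ _ ∘ₗ .inl _ _ _)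
  obtain ⟨v₄, h₄⟩ := hdual (f ∘ₗ .inr _ _ _ ∘ₗ .inr _ _ _)
  refine ⟨-v₂, v₁, v₄, -v₃, fun z => ?_⟩
  have hz : z = ((z.1.1, 0), 0) + ((0, z.1.2), 0) + (0, (z.2.1, 0)) + (0, (0, z.2.2)) := by
    ext <;> simp
  have e₁ : f ((z.1.1, 0), 0) = z.1.1 ⬝ᵥ v₁ := h₁ z.1.1
  have e₂ : f ((0, z.1.2), 0) = z.1.2 ⬝ᵥ v₂ := h₂ z.1.2
  have e₃ : f (0, (z.2.1, 0)) = z.2.1 ⬝ᵥ v₃ := h₃ z.2.1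
  have e₄ : f (0, (0, z.2.2)) = z.2.2 ⬝ᵥ v₄ := h₄ z.2.2
  conv_lhs => rw [hz]
  rw [map_add, map_add, map_add, e₁, e₂, e₃, e₄, dotProduct_neg, dotProduct_neg]
  ring

/-- The graph of `M` is its own orthogonal complement. -/
theorem graph_eq_of_orthogonal {ι : Type*} [Fintype ι] {M : Matrix ι ι ℚ_[p]}
    {a d c b : ι → ℚ_[p]}
    (h : ∀ a' b' : ι → ℚ_[p],
      (a' ⬝ᵥ d - (Mᵀ *ᵥ b') ⬝ᵥ a) - ((M *ᵥ a') ⬝ᵥ b - b' ⬝ᵥ c) = 0) :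
    c = M *ᵥ a ∧ d = Mᵀ *ᵥ b := by
  constructor
  · refine dotProduct_eq _ _ fun w => ?_
    have := h 0 w
    rw [mulVec_transpose, ← dotProduct_mulVec, mulVec_zero, zero_dotProduct,
      zero_dotProduct] at this
    rw [dotProduct_comm c, dotProduct_comm (M *ᵥ a)]
    linear_combination this
  · refine dotProduct_eq _ _ fun w => ?_
    have := h w 0
    rw [mulVec_zero, zero_dotProduct, zero_dotProduct, dotProduct_comm (M *ᵥ w),
      dotProduct_mulVec, ← mulVec_transpose, dotProduct_comm w] at this
    linear_combination this

theorem mem_chiM_of_mem_graphSum {M : Matrix (BigIx α k m) (BigIx α k m) ℚ_[p]}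
    {S S' : Set (SpV p k)} {w : SpV p α × SpV p α}
    (h : ((glue w.1.1 0, glue w.1.2 0), (glue w.2.1 0, glue w.2.2 0)) ∈ graphSum M S S') :
    w ∈ chiM p α k m M S S' := by
  obtain ⟨a, b, ⟨xp, xm, hx, ex⟩, ⟨yp, ym, hy, ey⟩⟩ := h
  have hg : ∀ (c : BigIx α k m → ℚ_[p]) (u : Fin α → ℚ_[p]) (x : Fin k → Fin m → ℚ_[p]),
      c - glue u 0 = glue 0 x → c = glue u x := fun c u x h => by
    rw [sub_eq_iff_eq_add.1 h, ← glue_add, zero_add, add_zero]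
  simp only [Prod.mk_sub_mk, Prod.mk.injEq] at ex ey
  have ha := hg _ _ _ ex.1
  have hb := hg _ _ _ ey.2
  refine ⟨xp, xm, yp, ym, hx, hy, ?_, ?_⟩
  · rw [← ha, hg _ _ _ ey.1]
  · rw [← hb, hg _ _ _ ex.2]

theorem IsSelfDual.chiM (M : Matrix (BigIx α k m) (BigIx α k m) ℚ_[p]) {S S' : Set (SpV p k)}
    (hS : IsSelfDual p (Bform p k) S) (hS' : IsSelfDual p (Bform p k) S') :
    IsSelfDual p (Bminus p α) (chiM p α k m M S S') := by
  have hSm := hS.isZpSubmodule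
  have hSm' := hS'.isZpSubmodule
  have hN := hSm.fiberModule (α := α) (m := m)
  have hN' := hSm'.fiberModule (α := α) (m := m)
  refine Set.Subset.antisymm (fun w hw => ?_) fun w hw v hv =>
    norm_Bminus_le_of_mem_chiM M zero_le_one (fun _ hv _ hw => hS.norm_le_one hv hw)
      (fun _ hv _ hw => hS'.norm_le_one hv hw) hv hw
  by_contra hwn
  obtain ⟨f, hf, hfw⟩ := (IsZpSubmodule.graphSum M hSm hSm').exists_separating
    (mt mem_chiM_of_mem_graphSum hwn)
  obtain ⟨a, d, c, b, hrep⟩ := exists_symplectic_representation f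
  have hgraph : ∀ a' b', f ((a', Mᵀ *ᵥ b'), (M *ᵥ a', b')) = 0 := fun a' b' => by
    refine eq_zero_of_norm_mul_le_one fun t => ?_
    rw [← smul_eq_mul, ← map_smul]
    refine hf _ ⟨t • a', t • b', ?_, ?_⟩
    · simpa [mulVec_smul] using hN.1
    · simpa [mulVec_smul] using hN'.1
  obtain ⟨hc, hd⟩ := graph_eq_of_orthogonal (M := M) (a := a) (d := d) (c := c) (b := b)
    fun a' b' => by rw [← hgraph a' b', hrep]
  have hx := tupleSlice_mem_dualMod hSm (a := a) (d := d) fun q hq => by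
    have := hf (q, 0) (mem_graphSum_of_neg_mem M (hN.neg_mem hq) (hN'.neg_mem hN'.1))
    simpa [hrep] using this
  have hy := tupleSlice_mem_dualMod hSm' (a := c) (d := b) fun q hq => by
    have := hf (0, q) (mem_graphSum_of_neg_mem M (hN.neg_mem hN.1) (hN'.neg_mem hq))
    rw [hrep, ← norm_neg] at this
    simpa using this
  rw [hS] at hx
  rw [hS'] at hy
  have hz : ((fun i => a (.inl i), fun i => d (.inl i)),
      (fun i => c (.inl i), fun i => b (.inl i))) ∈ _root_.chiM p α k m M S S' :=
    ⟨_, _, _, _, hx, hy, by simp only [glue_restrict, hc], by simp only [glue_restrict, hd]⟩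
  have hle := hw _ hz
  rw [Bminus_swap, norm_neg] at hle
  have h0 : ∀ y, Bform p k 0 y = 0 := fun y => by simp [Bform]
  have hsl : ∀ s, tupleSlice (0 : Fin k → Fin m → ℚ_[p]) 0 s = 0 := fun _ => rfl
  have h₁ := glue_symplectic w.1 (fun i => a (.inl i), fun i => d (.inl i)) 0 0
    (fun (j : Fin k) (s : Fin m) => a (.inr (j, s))) (fun j s => d (.inr (j, s)))
  have h₂ := glue_symplectic w.2 (fun i => c (.inl i), fun i => b (.inl i)) 0 0
    (fun (j : Fin k) (s : Fin m) => c (.inr (j, s))) (fun j s => b (.inr (j, s)))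
  simp only [glue_restrict, hsl, h0, Finset.sum_const_zero, add_zero] at h₁ h₂
  rw [hrep, h₁, h₂] at hfw
  exact absurd hle (not_le.2 hfw)

theorem chiM_mono (M : Matrix (BigIx α k m) (BigIx α k m) ℚ_[p]) {S S' Q T : Set (SpV p k)}
    (hS : S ⊆ Q) (hS' : S' ⊆ T) : chiM p α k m M S S' ⊆ chiM p α k m M Q T := by
  rintro z ⟨xp, xm, yp, ym, hx, hy, h₁, h₂⟩
  exact ⟨xp, xm, yp, ym, fun s => hS (hx s), fun s => hS' (hy s), h₁, h₂⟩

end Forms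

/-- **Almost self-dual modules are preserved:** if `Q` and `T` are almost self-dual
`ℤ_p`-submodules of `H`, then for every `g ∈ GL(α + km, ℚ_p)` the submodule
`χ_g(Q, T) ⊆ V ⊕ V` is almost self-dual with respect to `B^⊖`. -/
theorem chi_almost_self_dual (p : ℕ) [Fact p.Prime] (α k m : ℕ) (hk : 1 ≤ k) (hm : 1 ≤ m)
    (M : Matrix (BigIx α k m) (BigIx α k m) ℚ_[p]) (hM : IsUnit M)
    (Q T : Set (SpV p k)) (hQmod : IsZpSubmodule p Q) (hTmod : IsZpSubmodule p T)
    (hQ : IsAlmostSelfDual p (Bform p k) Q) (hT : IsAlmostSelfDual p (Bform p k) T) :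
    IsAlmostSelfDual p (Bminus p α) (chiM p α k m M Q T) := by
  obtain ⟨⟨S, hSQ, hS⟩, hQ⟩ := hQ
  obtain ⟨⟨S', hST, hS'⟩, hT⟩ := hT
  exact ⟨⟨_, chiM_mono M hSQ hST, hS.chiM M hS'⟩, fun v hv w hw =>
    norm_Bminus_le_of_mem_chiM M (Nat.cast_nonneg p) hQ hT hv hw⟩
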